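/- Identity for the subleading coefficient for the generalized Jacobi weight: let ℓ_{n,n−1} denote the coefficient of z^{n−1} in Φ_n. Then for every n ≥ 1, (conj(d)+n)·conj(ℓ_{n,n−1}) + (d+n)·ℓ_{n,n−1} + 2n(β−λ) = 0, where d = λ + β + iη. -/

import Mathlib

open Polynomial MeasureTheory

theorem continuous_mul_sq_rpow {r : ℝ} (hr : -1/2 < r) :
    Continuous fun x : ℝ => x * (x ^ 2) ^ r := by
  rw [continuous_iff_continuousAt]
  intro x
  rcases eq_or_ne x 0 with rfl | hx
  · have hlim : Filter.Tendsto (fun x : ℝ => |x| ^ (1 + 2 * r)) (nhds 0) (nhds 0) := by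
      have h : ContinuousAt (fun x : ℝ => |x| ^ (1 + 2 * r)) 0 :=
        continuous_abs.continuousAt.rpow_const (Or.inr (by linarith))
      simpa [ContinuousAt, Real.zero_rpow (show 1 + 2 * r ≠ 0 by linarith)] using h
    have hz : (fun x : ℝ => x * (x ^ 2) ^ r) 0 = 0 := by simp
    change Filter.Tendsto _ _ (nhds ((fun x : ℝ => x * (x ^ 2) ^ r) 0))
    rw [hz]
    refine squeeze_zero_norm (fun x => ?_) hlim
    rcases eq_or_ne x 0 with rfl | hx
    · simp [Real.zero_rpow (show 1 + 2 * r ≠ 0 by linarith)]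
    · have hpos : 0 < |x| := abs_pos.mpr hx
      rw [Real.rpow_add hpos, Real.rpow_one, Real.rpow_mul hpos.le, Real.norm_eq_abs, abs_mul,
        Real.rpow_two, sq_abs, abs_of_nonneg (Real.rpow_nonneg (sq_nonneg x) r)]
  · exact continuousAt_id.mul ((continuousAt_id.pow 2).rpow_const (Or.inl (pow_ne_zero 2 hx)))

theorem HasDerivAt.sq_rpow {f : ℝ → ℝ} {f' x : ℝ} (hf : HasDerivAt f f' x) (hx : f x ≠ 0) (r : ℝ) :
    HasDerivAt (fun y => (f y ^ 2) ^ r) (2 * r * f' * (f x ^ 2) ^ r / f x) x := by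
  have h := (hf.fun_pow 2).rpow_const (p := r) (Or.inl (pow_ne_zero 2 hx))
  convert h using 1
  rw [Real.rpow_sub_one (pow_ne_zero 2 hx)]
  field_simp
  norm_num
  exact Or.inl (by ring)

theorem HasDerivAt.mul_sq_rpow {f : ℝ → ℝ} {f' x : ℝ} (hf : HasDerivAt f f' x) (hx : f x ≠ 0)
    (r : ℝ) :
    HasDerivAt (fun y => f y * (f y ^ 2) ^ r) ((1 + 2 * r) * ((f x ^ 2) ^ r * f')) x := by
  refine (hf.fun_mul (hf.sq_rpow hx r)).congr_deriv ?_
  field_simp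

/-- `(f ^ 2) ^ r * f'` is integrable when `f` does not vanish and `f'` has constant sign inside the
interval. -/
theorem intervalIntegrable_sq_rpow_mul_deriv {f f' : ℝ → ℝ} {a b r : ℝ} (hr : -1/2 < r)
    (hab : a ≤ b)
    (hf : ∀ x, HasDerivAt f (f' x) x) (hne : ∀ x ∈ Set.Ioo a b, f x ≠ 0)
    (hsign : (∀ x ∈ Set.Ioo a b, 0 ≤ f' x) ∨ (∀ x ∈ Set.Ioo a b, f' x ≤ 0)) :
    IntervalIntegrable (fun x => (f x ^ 2) ^ r * f' x) volume a b := by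
  have hcont : Continuous f := continuous_iff_continuousAt.mpr fun x => (hf x).continuousAt
  have hg : Continuous fun x => f x * (f x ^ 2) ^ r := (continuous_mul_sq_rpow hr).comp hcont
  have hr' : 0 < 1 + 2 * r := by linarith
  suffices h : IntervalIntegrable (fun x => (1 + 2 * r) * ((f x ^ 2) ^ r * f' x)) volume a b by
    have := h.const_mul (1 + 2 * r)⁻¹
    simpa [← mul_assoc, hr'.ne'] using this
  rcases hsign with hs | hs
  · refine intervalIntegral.intervalIntegrable_deriv_of_nonneg hg.continuousOn ?_ ?_ <;>
      rw [min_eq_left hab, max_eq_right hab]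
    · exact fun x hx => (hf x).mul_sq_rpow (hne x hx) r
    · exact fun x hx => mul_nonneg hr'.le
        (mul_nonneg (Real.rpow_nonneg (sq_nonneg _) _) (hs x hx))
  · have h : IntervalIntegrable (fun x => -((1 + 2 * r) * ((f x ^ 2) ^ r * f' x))) volume a b := by
      refine intervalIntegral.intervalIntegrable_deriv_of_nonneg hg.neg.continuousOn ?_ ?_ <;>
        rw [min_eq_left hab, max_eq_right hab]
      · exact fun x hx => ((hf x).mul_sq_rpow (hne x hx) r).neg
      · exact fun x hx => neg_nonneg.mpr (mul_nonpos_of_nonneg_of_nonpos hr'.le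
          (mul_nonpos_of_nonneg_of_nonpos (Real.rpow_nonneg (sq_nonneg _) _) (hs x hx)))
    simpa only [Pi.neg_def, neg_neg] using h.neg

theorem Real.rpow_le_two_rpow_abs {x : ℝ} (h : 1 / 2 ≤ x) (h1 : x ≤ 1) (r : ℝ) :
    x ^ r ≤ 2 ^ |r| := by
  rcases le_total 0 r with hr | hr
  · exact (Real.rpow_le_one (by linarith) h1 hr).trans
      (Real.one_le_rpow one_le_two (abs_nonneg r))
  · rw [abs_of_nonpos hr, Real.rpow_neg two_pos.le, ← Real.inv_rpow two_pos.le]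
    exact Real.rpow_le_rpow_of_nonpos (by norm_num) (by linarith) hr

theorem sq_rpow_mul_sq_rpow_le {s c : ℝ} (h : s ^ 2 + c ^ 2 = 1) (hs : 1 / 2 ≤ s ^ 2) (p q : ℝ) :
    (s ^ 2) ^ p * (c ^ 2) ^ q ≤ 2 ^ |p - 1 / 2| * |(c ^ 2) ^ q * s| := by
  have hpos : 0 < s ^ 2 := by linarith
  have hsplit : (s ^ 2) ^ p = (s ^ 2) ^ (p - 1 / 2) * |s| := by
    rw [← Real.sqrt_sq_eq_abs, Real.sqrt_eq_rpow, ← Real.rpow_add hpos]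
    norm_num
  have hb := Real.rpow_le_two_rpow_abs hs (by nlinarith [sq_nonneg c]) (p - 1 / 2)
  have hc : 0 ≤ (c ^ 2) ^ q := Real.rpow_nonneg (sq_nonneg c) q
  rw [hsplit, abs_mul, abs_of_nonneg hc]
  calc _ = (s ^ 2) ^ (p - 1 / 2) * ((c ^ 2) ^ q * |s|) := by ring
    _ ≤ _ := mul_le_mul_of_nonneg_right hb (mul_nonneg hc (abs_nonneg s))

theorem hasDerivAt_sin_half (x : ℝ) :
    HasDerivAt (fun θ : ℝ => Real.sin (θ / 2)) (Real.cos (x / 2) / 2) x := by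
  simpa [div_eq_mul_inv] using ((hasDerivAt_id x).div_const 2).sin

theorem hasDerivAt_cos_half (x : ℝ) :
    HasDerivAt (fun θ : ℝ => Real.cos (θ / 2)) (-(Real.sin (x / 2) / 2)) x := by
  simpa [div_eq_mul_inv] using ((hasDerivAt_id x).div_const 2).cos

theorem sin_half_pos {x : ℝ} (hx : x ∈ Set.Ioo 0 (2 * Real.pi)) : 0 < Real.sin (x / 2) :=
  Real.sin_pos_of_pos_of_lt_pi (by linarith [hx.1]) (by linarith [hx.2])

theorem cos_half_pos {x : ℝ} (hx : x ∈ Set.Ioo 0 Real.pi) : 0 < Real.cos (x / 2) :=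
  Real.cos_pos_of_mem_Ioo ⟨by linarith [hx.1, Real.pi_pos], by linarith [hx.2]⟩

theorem cos_half_neg {x : ℝ} (hx : x ∈ Set.Ioo Real.pi (2 * Real.pi)) : Real.cos (x / 2) < 0 :=
  Real.cos_neg_of_pi_div_two_lt_of_lt (by linarith [hx.1]) (by linarith [hx.2, Real.pi_pos])

theorem intervalIntegrable_sin_sq_rpow_mul_cos_sq_rpow {p q : ℝ} (hp : -1/2 < p) (hq : -1/2 < q) :
    IntervalIntegrable
      (fun θ : ℝ => (Real.sin (θ / 2) ^ 2) ^ p * (Real.cos (θ / 2) ^ 2) ^ q)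
      volume 0 (2 * Real.pi) := by
  have hpi := Real.pi_pos
  have hle : Real.pi ≤ 2 * Real.pi := by linarith
  have hl : ∀ x ∈ Set.Ioo 0 Real.pi, x ∈ Set.Ioo 0 (2 * Real.pi) :=
    fun x hx => ⟨hx.1, hx.2.trans_le hle⟩
  have hu : ∀ x ∈ Set.Ioo Real.pi (2 * Real.pi), x ∈ Set.Ioo 0 (2 * Real.pi) :=
    fun x hx => ⟨hpi.trans hx.1, hx.2⟩
  have hsin : IntervalIntegrable
      (fun θ : ℝ => (Real.sin (θ / 2) ^ 2) ^ p * (Real.cos (θ / 2) / 2))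
      volume 0 (2 * Real.pi) := by
    refine (intervalIntegrable_sq_rpow_mul_deriv hp hpi.le hasDerivAt_sin_half ?_ (Or.inl ?_)).trans
      (intervalIntegrable_sq_rpow_mul_deriv hp hle hasDerivAt_sin_half ?_ (Or.inr ?_))
    · exact fun x hx => (sin_half_pos (hl x hx)).ne'
    · exact fun x hx => by linarith [cos_half_pos hx]
    · exact fun x hx => (sin_half_pos (hu x hx)).ne'
    · exact fun x hx => by linarith [cos_half_neg hx]
  have hcos : IntervalIntegrable
      (fun θ : ℝ => (Real.cos (θ / 2) ^ 2) ^ q * -(Real.sin (θ / 2) / 2))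
      volume 0 (2 * Real.pi) := by
    refine (intervalIntegrable_sq_rpow_mul_deriv hq hpi.le hasDerivAt_cos_half ?_ (Or.inr ?_)).trans
      (intervalIntegrable_sq_rpow_mul_deriv hq hle hasDerivAt_cos_half ?_ (Or.inr ?_))
    · exact fun x hx => (cos_half_pos hx).ne'
    · exact fun x hx => by linarith [sin_half_pos (hl x hx)]
    · exact fun x hx => (cos_half_neg hx).ne
    · exact fun x hx => by linarith [sin_half_pos (hu x hx)]
  refine ((hcos.norm.const_mul (2 * 2 ^ |p - 1 / 2|)).add
    (hsin.norm.const_mul (2 * 2 ^ |q - 1 / 2|))).mono_fun' ?_ (Filter.Eventually.of_forall ?_)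
  · exact Measurable.aestronglyMeasurable (by fun_prop)
  · intro θ
    have h1 := Real.sin_sq_add_cos_sq (θ / 2)
    have h2 : (0 : ℝ) ≤ 2 ^ |p - 1 / 2| := by positivity
    have h3 : (0 : ℝ) ≤ 2 ^ |q - 1 / 2| := by positivity
    have e1 : ‖(Real.cos (θ / 2) ^ 2) ^ q * -(Real.sin (θ / 2) / 2)‖
        = |(Real.cos (θ / 2) ^ 2) ^ q * Real.sin (θ / 2)| / 2 := by
      rw [Real.norm_eq_abs, mul_neg, abs_neg, ← mul_div_assoc, abs_div, abs_two]
    have e2 : ‖(Real.sin (θ / 2) ^ 2) ^ p * (Real.cos (θ / 2) / 2)‖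
        = |(Real.sin (θ / 2) ^ 2) ^ p * Real.cos (θ / 2)| / 2 := by
      rw [Real.norm_eq_abs, ← mul_div_assoc, abs_div, abs_two]
    simp only [e1, e2]
    rw [Real.norm_of_nonneg (by positivity)]
    have a1 := mul_nonneg h2 (abs_nonneg ((Real.cos (θ / 2) ^ 2) ^ q * Real.sin (θ / 2)))
    have a2 := mul_nonneg h3 (abs_nonneg ((Real.sin (θ / 2) ^ 2) ^ p * Real.cos (θ / 2)))
    rcases le_total (1 / 2) (Real.sin (θ / 2) ^ 2) with hs | hs
    · linarith [sq_rpow_mul_sq_rpow_le h1 hs p q]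
    · have := sq_rpow_mul_sq_rpow_le ((add_comm _ _).trans h1)
        (show 1 / 2 ≤ Real.cos (θ / 2) ^ 2 by linarith) q p
      rw [mul_comm ((Real.sin (θ / 2) ^ 2) ^ p)]
      linarith

/-- The generalized Jacobi weight on the unit circle. -/
noncomputable def circleJacobiWeight (lam β η θ : ℝ) : ℝ :=
  Real.exp (-η * θ) * (Real.sin (θ / 2) ^ 2) ^ lam * (Real.cos (θ / 2) ^ 2) ^ β

section Weight

variable {lam β : ℝ} (η : ℝ)

theorem intervalIntegrable_circleJacobiWeight (hlam : -1/2 < lam) (hβ : -1/2 < β) :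
    IntervalIntegrable (circleJacobiWeight lam β η) volume 0 (2 * Real.pi) := by
  have h := (intervalIntegrable_sin_sq_rpow_mul_cos_sq_rpow hlam hβ).continuousOn_mul
    (g := fun θ => Real.exp (-η * θ)) (by fun_prop)
  exact h.congr fun θ _ => (mul_assoc _ _ _).symm

theorem IntervalIntegrable.mul_circleJacobiWeight (hlam : -1/2 < lam) (hβ : -1/2 < β) {f : ℝ → ℂ}
    (hf : Continuous f) :
    IntervalIntegrable (fun θ => f θ * (circleJacobiWeight lam β η θ : ℂ))
      volume 0 (2 * Real.pi) :=
  (show IntervalIntegrable (fun θ => (circleJacobiWeight lam β η θ : ℂ)) volume 0 (2 * Real.pi) from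
    (⟨(intervalIntegrable_circleJacobiWeight η hlam hβ).1.ofReal,
      (intervalIntegrable_circleJacobiWeight η hlam hβ).2.ofReal⟩)).continuousOn_mul hf.continuousOn

theorem continuous_sin_mul_circleJacobiWeight (hlam : -1/2 < lam) (hβ : -1/2 < β) :
    Continuous fun θ => Real.sin θ * circleJacobiWeight lam β η θ := by
  have hs := (continuous_mul_sq_rpow hlam).comp (f := fun θ : ℝ => Real.sin (θ / 2)) (by fun_prop)
  have hc := (continuous_mul_sq_rpow hβ).comp (f := fun θ : ℝ => Real.cos (θ / 2)) (by fun_prop)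
  have he : Continuous fun θ : ℝ => 2 * Real.exp (-η * θ) := by fun_prop
  convert he.mul (hs.mul hc) using 1
  funext θ
  have h : Real.sin θ = 2 * Real.sin (θ / 2) * Real.cos (θ / 2) := by
    rw [← Real.sin_two_mul]; congr 1; ring
  simp only [circleJacobiWeight, Function.comp_apply, h, Pi.mul_apply]
  ring

theorem hasDerivAt_sin_mul_circleJacobiWeight {x : ℝ} (hs : Real.sin (x / 2) ≠ 0)
    (hc : Real.cos (x / 2) ≠ 0) :
    HasDerivAt (fun θ => Real.sin θ * circleJacobiWeight lam β η θ)
      (((1 + lam + β) * Real.cos x - η * Real.sin x + (lam - β)) *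
        circleJacobiWeight lam β η x) x := by
  have he : HasDerivAt (fun θ : ℝ => Real.exp (-η * θ)) (Real.exp (-η * x) * (-η * 1)) x :=
    ((hasDerivAt_id x).const_mul (-η)).exp
  have h := (Real.hasDerivAt_sin x).fun_mul
    ((he.fun_mul ((hasDerivAt_sin_half x).sq_rpow hs lam)).fun_mul ((hasDerivAt_cos_half x).sq_rpow hc β))
  refine h.congr_deriv ?_
  have h1 : Real.sin x = 2 * Real.sin (x / 2) * Real.cos (x / 2) := by
    rw [← Real.sin_two_mul]; congr 1; ring
  have h2 : Real.cos x = 2 * Real.cos (x / 2) ^ 2 - 1 := by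
    rw [← Real.cos_two_mul]; congr 1; ring
  have h3 : Real.sin (x / 2) ^ 2 = 1 - Real.cos (x / 2) ^ 2 := by
    rw [← Real.sin_sq_add_cos_sq (x / 2)]; ring
  simp only [circleJacobiWeight, h1, h2]
  generalize (Real.sin (x / 2) ^ 2) ^ lam = A
  generalize (Real.cos (x / 2) ^ 2) ^ β = B
  field_simp
  linear_combination (-2 * β * A * B) * h3

/-- Pearson equation for the generalized Jacobi weight, in integrated form. -/
theorem integral_pearson_circleJacobiWeight (hlam : -1/2 < lam) (hβ : -1/2 < β) {f f' : ℝ → ℂ}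
    (hf : ∀ x, HasDerivAt f (f' x) x) (hf' : Continuous f') :
    ∫ θ in (0 : ℝ)..(2 * Real.pi),
      ((((1 + lam + β) * Real.cos θ - η * Real.sin θ + (lam - β) : ℝ) : ℂ) * f θ
        + (Real.sin θ : ℂ) * f' θ) * (circleJacobiWeight lam β η θ : ℂ) = 0 := by
  have hcont : Continuous f := continuous_iff_continuousAt.mpr fun x => (hf x).continuousAt
  have hg : Continuous fun θ => ((Real.sin θ * circleJacobiWeight lam β η θ : ℝ) : ℂ) :=
    Complex.continuous_ofReal.comp (continuous_sin_mul_circleJacobiWeight η hlam hβ)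
  rw [integral_eq_of_hasDerivAt_off_countable_of_le
    (fun θ => ((Real.sin θ * circleJacobiWeight lam β η θ : ℝ) : ℂ) * f θ) _
    (by linarith [Real.pi_pos]) (Set.countable_singleton Real.pi) (hg.mul hcont).continuousOn ?_ ?_]
  · simp
  · rintro x ⟨hx, hxpi⟩
    have hc : Real.cos (x / 2) ≠ 0 := by
      rcases lt_or_gt_of_ne hxpi with h | h
      · exact (cos_half_pos ⟨hx.1, h⟩).ne'
      · exact (cos_half_neg ⟨h, hx.2⟩).ne
    have h := (hasDerivAt_sin_mul_circleJacobiWeight (lam := lam) (β := β) η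
      (sin_half_pos hx).ne' hc).ofReal_comp.fun_mul (hf x)
    refine h.congr_deriv ?_
    push_cast
    ring
  · exact IntervalIntegrable.mul_circleJacobiWeight η hlam hβ (by fun_prop)

end Weight

/-- The pairing `p ↦ ⟨p, q⟩` of polynomials on the unit circle with respect to a real weight. -/
noncomputable def circlePairing (w : ℝ → ℝ) (p q : ℂ[X]) : ℂ :=
  ∫ θ in (0 : ℝ)..(2 * Real.pi), p.eval (Complex.exp (θ * Complex.I)) *
    (starRingEnd ℂ) (q.eval (Complex.exp (θ * Complex.I))) * (w θ : ℂ)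

section Pairing

variable {w : ℝ → ℝ}

theorem continuous_eval_exp_mul_I (p : ℂ[X]) :
    Continuous fun θ : ℝ => p.eval (Complex.exp (θ * Complex.I)) :=
  p.continuous.comp (by fun_prop)

theorem intervalIntegrable_circlePairing
    (hw : IntervalIntegrable (fun θ => (w θ : ℂ)) volume 0 (2 * Real.pi)) (p q : ℂ[X]) :
    IntervalIntegrable (fun θ : ℝ => p.eval (Complex.exp (θ * Complex.I)) *
      (starRingEnd ℂ) (q.eval (Complex.exp (θ * Complex.I))) * (w θ : ℂ))
      volume 0 (2 * Real.pi) :=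
  hw.continuousOn_mul ((continuous_eval_exp_mul_I p).mul
    (Complex.continuous_conj.comp (continuous_eval_exp_mul_I q))).continuousOn

theorem circlePairing_add
    (hw : IntervalIntegrable (fun θ => (w θ : ℂ)) volume 0 (2 * Real.pi)) (p₁ p₂ q : ℂ[X]) :
    circlePairing w (p₁ + p₂) q = circlePairing w p₁ q + circlePairing w p₂ q := by
  simp only [circlePairing, eval_add, add_mul]
  exact intervalIntegral.integral_add (intervalIntegrable_circlePairing hw p₁ q)
    (intervalIntegrable_circlePairing hw p₂ q)

theorem circlePairing_C_mul (c : ℂ) (p q : ℂ[X]) :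
    circlePairing w (C c * p) q = c * circlePairing w p q := by
  simp only [circlePairing, eval_mul, eval_C, mul_assoc]
  exact intervalIntegral.integral_const_mul _ _

theorem circlePairing_conj (p q : ℂ[X]) :
    (starRingEnd ℂ) (circlePairing w p q) = circlePairing w q p := by
  simp only [circlePairing, ← intervalIntegral.intervalIntegral_conj, map_mul, Complex.conj_conj,
    Complex.conj_ofReal]
  simp only [mul_comm]

theorem circlePairing_sum
    (hw : IntervalIntegrable (fun θ => (w θ : ℂ)) volume 0 (2 * Real.pi)) (s : Finset ℕ)
    (p : ℕ → ℂ[X]) (q : ℂ[X]) :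
    circlePairing w (∑ k ∈ s, p k) q = ∑ k ∈ s, circlePairing w (p k) q := by
  induction s using Finset.cons_induction with
  | empty => simp [circlePairing]
  | cons a s ha ih => rw [Finset.sum_cons, Finset.sum_cons, circlePairing_add hw, ih]

/-- `q` is orthogonal on the unit circle to all monomials of degree less than `n`. -/
def IsCircleOrthogonal (w : ℝ → ℝ) (n : ℕ) (q : ℂ[X]) : Prop :=
  ∀ k < n, circlePairing w (X ^ k) q = 0

theorem IsCircleOrthogonal.circlePairing_eq_zero {n : ℕ} {q : ℂ[X]} (hq : IsCircleOrthogonal w n q)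
    (hw : IntervalIntegrable (fun θ => (w θ : ℂ)) volume 0 (2 * Real.pi)) {p : ℂ[X]}
    (hp : ∀ m, n ≤ m → p.coeff m = 0) : circlePairing w p q = 0 := by
  rw [p.as_sum_range_C_mul_X_pow, circlePairing_sum hw]
  refine Finset.sum_eq_zero fun k _ => ?_
  rw [circlePairing_C_mul]
  rcases lt_or_ge k n with hk | hk
  · rw [hq k hk, mul_zero]
  · rw [hp k hk, zero_mul]

theorem circlePairing_self_ne_zero
    (hw : IntervalIntegrable w volume 0 (2 * Real.pi)) (hw0 : ∀ θ, 0 ≤ w θ)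
    (hwpos : ∀ θ ∈ Set.Ioo 0 Real.pi, 0 < w θ) {q : ℂ[X]} (hq : q ≠ 0) :
    circlePairing w q q ≠ 0 := by
  set E : ℝ → ℂ := fun θ => Complex.exp (θ * Complex.I) with hE
  set f : ℝ → ℝ := fun θ => Complex.normSq (q.eval (E θ)) * w θ with hf
  have hfe : circlePairing w q q = ((∫ θ in (0 : ℝ)..(2 * Real.pi), f θ : ℝ) : ℂ) := by
    rw [← intervalIntegral.integral_ofReal]
    simp only [circlePairing, hf, hE, Complex.mul_conj, Complex.ofReal_mul]
  have hfi : IntervalIntegrable f volume 0 (2 * Real.pi) :=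
    hw.continuousOn_mul
      (Complex.continuous_normSq.comp (continuous_eval_exp_mul_I q)).continuousOn
  have hf0 : ∀ θ, 0 ≤ f θ := fun θ => mul_nonneg (Complex.normSq_nonneg _) (hw0 θ)
  have hinj : Set.InjOn E (Set.Ioo 0 Real.pi) := fun x hx y hy hxy => by
    refine Real.injOn_cos (Set.Ioo_subset_Icc_self hx) (Set.Ioo_subset_Icc_self hy) ?_
    simpa [hE, Complex.exp_ofReal_mul_I_re] using congrArg Complex.re hxy
  have hfin : (Set.Ioo 0 Real.pi ∩ E ⁻¹' {z | q.IsRoot z}).Finite := by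
    refine Set.Finite.of_finite_image ((q.finite_setOfPred_isRoot hq).subset ?_)
      (hinj.mono Set.inter_subset_left)
    rintro _ ⟨x, hx, rfl⟩
    exact hx.2
  have hpos : 0 < ∫ θ in (0 : ℝ)..(2 * Real.pi), f θ := by
    rw [intervalIntegral.integral_pos_iff_support_of_nonneg_ae (Filter.Eventually.of_forall hf0) hfi]
    refine ⟨Real.two_pi_pos, ?_⟩
    have hsub : Set.Ioo 0 Real.pi \ (Set.Ioo 0 Real.pi ∩ E ⁻¹' {z | q.IsRoot z}) ⊆
        Function.support f ∩ Set.Ioc 0 (2 * Real.pi) := by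
      rintro x ⟨hx, hxr⟩
      refine ⟨mul_ne_zero ?_ (hwpos x hx).ne', hx.1, by linarith [hx.1, hx.2]⟩
      exact fun h => hxr ⟨hx, Complex.normSq_eq_zero.mp h⟩
    refine lt_of_lt_of_le ?_ (measure_mono hsub)
    rw [measure_sdiff_null (hfin.measure_zero volume)]
    simp [Real.pi_pos]
  rw [hfe]
  exact_mod_cast hpos.ne'

end Pairing

section Monic

variable {w : ℝ → ℝ} {Φ : ℕ → ℂ[X]}

theorem coeff_of_natDegree_lt_monic (hdeg : ∀ n, (Φ n).natDegree = n) {n m : ℕ} (h : n < m) :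
    (Φ n).coeff m = 0 :=
  coeff_eq_zero_of_natDegree_lt ((hdeg n).symm ▸ h)

theorem coeff_self_of_monic (hmonic : ∀ n, (Φ n).Monic) (hdeg : ∀ n, (Φ n).natDegree = n) (n : ℕ) :
    (Φ n).coeff n = 1 := by
  simpa [Monic, leadingCoeff, hdeg n] using hmonic n

theorem circlePairing_X_mul_self (hw : IntervalIntegrable (fun θ => (w θ : ℂ)) volume 0 (2 * Real.pi))
    (hmonic : ∀ n, (Φ n).Monic) (hdeg : ∀ n, (Φ n).natDegree = n)
    (horth : ∀ n, IsCircleOrthogonal w n (Φ n)) (n : ℕ) :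
    circlePairing w (X * Φ n) (Φ n) =
      ((X * Φ n).coeff n - (Φ (n + 1)).coeff n) * circlePairing w (Φ n) (Φ n) := by
  set c := (X * Φ n).coeff n - (Φ (n + 1)).coeff n with hc
  have h0 : circlePairing w (Φ (n + 1)) (Φ n) = 0 := by
    rw [← circlePairing_conj, (horth (n + 1)).circlePairing_eq_zero hw, map_zero]
    exact fun m hm => coeff_of_natDegree_lt_monic hdeg hm
  have h1 : circlePairing w (X * Φ n + (C (-1) * Φ (n + 1) + C (-c) * Φ n)) (Φ n) = 0 := by
    refine (horth n).circlePairing_eq_zero hw fun m hm => ?_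
    simp only [coeff_add, coeff_C_mul]
    rcases hm.eq_or_lt with rfl | hm
    · rw [coeff_self_of_monic hmonic hdeg, hc]
      ring
    · obtain ⟨m, rfl⟩ : ∃ k, m = k + 1 := ⟨m - 1, by omega⟩
      rw [coeff_X_mul, coeff_of_natDegree_lt_monic hdeg hm]
      rcases (Nat.lt_succ_iff.mp hm).eq_or_lt with rfl | hm'
      · rw [coeff_self_of_monic hmonic hdeg, coeff_self_of_monic hmonic hdeg]
        ring
      · rw [coeff_of_natDegree_lt_monic hdeg hm',
          coeff_of_natDegree_lt_monic hdeg (Nat.succ_lt_succ hm')]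
        ring
  rw [circlePairing_add hw, circlePairing_add hw, circlePairing_C_mul, circlePairing_C_mul, h0] at h1
  linear_combination h1

theorem coeff_X_sq_mul_derivative (p : ℂ[X]) (m : ℕ) :
    (X ^ 2 * derivative p).coeff (m + 1) = m * p.coeff m := by
  rcases m with _ | m
  · simp [pow_two, mul_assoc]
  · rw [coeff_X_pow_mul, coeff_derivative]
    push_cast
    ring

theorem circlePairing_X_sq_mul_derivative
    (hw : IntervalIntegrable (fun θ => (w θ : ℂ)) volume 0 (2 * Real.pi))
    (hmonic : ∀ n, (Φ n).Monic) (hdeg : ∀ n, (Φ n).natDegree = n)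
    (horth : ∀ n, IsCircleOrthogonal w n (Φ n)) (n : ℕ) :
    circlePairing w (X ^ 2 * derivative (Φ n)) (Φ n) =
      n * circlePairing w (X * Φ n) (Φ n) -
        (X * Φ n).coeff n * circlePairing w (Φ n) (Φ n) := by
  have h : circlePairing w (X ^ 2 * derivative (Φ n) +
      (C (-(n : ℂ)) * (X * Φ n) + C ((X * Φ n).coeff n) * Φ n)) (Φ n) = 0 := by
    refine (horth n).circlePairing_eq_zero hw fun m hm => ?_
    simp only [coeff_add, coeff_C_mul]
    rcases hm.eq_or_lt with rfl | hm
    · rw [coeff_self_of_monic hmonic hdeg]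
      rcases n with _ | n
      · simp
      · rw [coeff_X_sq_mul_derivative, coeff_X_mul]
        push_cast
        ring
    · obtain ⟨m, rfl⟩ : ∃ k, m = k + 1 := ⟨m - 1, by omega⟩
      rw [coeff_X_sq_mul_derivative, coeff_X_mul, coeff_of_natDegree_lt_monic hdeg hm]
      rcases (Nat.lt_succ_iff.mp hm).eq_or_lt with rfl | hm'
      · ring
      · rw [coeff_of_natDegree_lt_monic hdeg hm']
        ring
  rw [circlePairing_add hw, circlePairing_add hw, circlePairing_C_mul, circlePairing_C_mul] at h
  linear_combination h

theorem circlePairing_derivative_self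
    (hw : IntervalIntegrable (fun θ => (w θ : ℂ)) volume 0 (2 * Real.pi))
    (hdeg : ∀ n, (Φ n).natDegree = n)
    (horth : ∀ n, IsCircleOrthogonal w n (Φ n)) (n : ℕ) :
    circlePairing w (derivative (Φ n)) (Φ n) = 0 := by
  refine (horth n).circlePairing_eq_zero hw fun m hm => ?_
  rw [coeff_derivative, coeff_of_natDegree_lt_monic hdeg (Nat.lt_succ_of_le hm), zero_mul]

end Monic

theorem hasDerivAt_eval_exp_mul_I (p : ℂ[X]) (x : ℝ) :
    HasDerivAt (fun θ : ℝ => p.eval (Complex.exp (θ * Complex.I)))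
      ((derivative p).eval (Complex.exp (x * Complex.I)) *
        (Complex.exp (x * Complex.I) * Complex.I)) x := by
  have h : HasDerivAt (fun θ : ℝ => Complex.exp (θ * Complex.I))
      (Complex.exp (x * Complex.I) * Complex.I) x := by
    simpa using ((Complex.ofRealCLM.hasDerivAt (x := x)).mul_const Complex.I).cexp
  exact (p.hasDerivAt _).comp x h

theorem circlePairing_pearson {lam β : ℝ} (η : ℝ) (hlam : -1/2 < lam) (hβ : -1/2 < β) {d : ℂ}
    (hd : d = (lam : ℂ) + (β : ℂ) + (η : ℂ) * Complex.I) (p : ℂ[X]) :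
    circlePairing (circleJacobiWeight lam β η)
        (X ^ 2 * derivative p + (C (-1) * derivative p + C (1 + d) * (X * p))) p +
      (starRingEnd ℂ) (circlePairing (circleJacobiWeight lam β η)
        (X ^ 2 * derivative p + (C (-1) * derivative p + C (1 + d) * (X * p))) p) +
      2 * ((lam : ℂ) - β) * circlePairing (circleJacobiWeight lam β η) p p = 0 := by
  set w := circleJacobiWeight lam β η with hwdef
  have hw : IntervalIntegrable (fun θ => (w θ : ℂ)) volume 0 (2 * Real.pi) := by
    simpa using IntervalIntegrable.mul_circleJacobiWeight η hlam hβ (continuous_const (y := (1 : ℂ)))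
  set a := X ^ 2 * derivative p + (C (-1) * derivative p + C (1 + d) * (X * p)) with ha
  have hstar : ∀ x : ℝ, HasDerivAt
      (fun θ : ℝ => (starRingEnd ℂ) (p.eval (Complex.exp (θ * Complex.I))))
      ((starRingEnd ℂ) ((derivative p).eval (Complex.exp (x * Complex.I)) *
        (Complex.exp (x * Complex.I) * Complex.I))) x :=
    fun x => (hasDerivAt_eval_exp_mul_I p x).star
  have hderiv := fun x : ℝ => (hasDerivAt_eval_exp_mul_I p x).fun_mul (hstar x)
  have hp := continuous_eval_exp_mul_I p
  have hp' := continuous_eval_exp_mul_I (derivative p)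
  have hpc := Complex.continuous_conj.comp hp
  have hq : Continuous fun θ : ℝ => (derivative p).eval (Complex.exp (θ * Complex.I)) *
        (Complex.exp (θ * Complex.I) * Complex.I) := hp'.mul (by fun_prop)
  have key := integral_pearson_circleJacobiWeight η hlam hβ hderiv
    ((hq.mul hpc).add (hp.mul (Complex.continuous_conj.comp hq)))
  rw [circlePairing_conj]
  have hia := intervalIntegrable_circlePairing hw a p
  have hib := intervalIntegrable_circlePairing hw p a
  have hic := (intervalIntegrable_circlePairing hw p p).const_mul (2 * ((lam : ℂ) - β))
  rw [circlePairing, circlePairing, circlePairing, ← intervalIntegral.integral_const_mul,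
    ← intervalIntegral.integral_add hia hib, ← intervalIntegral.integral_add (hia.add hib) hic,
    ← mul_zero (2 : ℂ), ← key, ← intervalIntegral.integral_const_mul]
  refine intervalIntegral.integral_congr fun θ _ => ?_
  have hEc : (starRingEnd ℂ) (Complex.exp (θ * Complex.I)) =
      Complex.cos θ - Complex.sin θ * Complex.I := by
    rw [Complex.exp_mul_I, map_add, map_mul, Complex.conj_I, ← Complex.ofReal_cos,
      ← Complex.ofReal_sin, Complex.conj_ofReal, Complex.conj_ofReal]
    ring
  have hcs := Complex.sin_sq_add_cos_sq (θ : ℂ)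
  simp only [ha, eval_add, eval_mul, eval_pow, eval_X, eval_C, eval_neg, eval_one, map_add, map_mul, map_pow,
    hEc, Complex.conj_I, hd, map_one, map_neg, Complex.conj_ofReal]
  push_cast
  rw [Complex.exp_mul_I]
  generalize eval _ (derivative p) = P'
  generalize eval _ p = P
  generalize (starRingEnd ℂ) P' = P'c
  generalize (starRingEnd ℂ) P = Pc
  linear_combination (w θ * (P' * Pc + P * P'c)) *
      (hcs - Complex.sin θ ^ 2 * Complex.I_sq) +
    2 * η * Complex.sin θ * P * Pc * w θ * Complex.I_sq

theorem stmt_17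
    (lam β η : ℝ) (hlam : -1/2 < lam) (hβ : -1/2 < β)
    (d : ℂ) (hd : d = (lam : ℂ) + (β : ℂ) + (η : ℂ) * Complex.I)
    (w : ℝ → ℝ)
    (hw : ∀ θ : ℝ, w θ = Real.exp (-η * θ) * (Real.sin (θ/2)^2) ^ lam * (Real.cos (θ/2)^2) ^ β)
    (Φ : ℕ → Polynomial ℂ)
    (hmonic : ∀ n, (Φ n).Monic)
    (hdeg : ∀ n, (Φ n).natDegree = n)
    (horth : ∀ n, ∀ k < n,
      ∫ θ in (0:ℝ)..(2*Real.pi),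
        (Φ n).eval (Complex.exp ((θ:ℂ) * Complex.I)) *
          Complex.exp (-(k : ℂ) * (θ:ℂ) * Complex.I) * (w θ : ℂ) = 0)
    (α : ℕ → ℂ)
    (hα : ∀ m, α m = -(starRingEnd ℂ) ((Φ (m+1)).coeff 0))
    (ℓ : ℕ → ℕ → ℂ)
    (hℓ : ∀ n k, ℓ n k = (Φ n).coeff k)
    :
    ∀ n : ℕ, 1 ≤ n →
      ((starRingEnd ℂ) (d) + (n:ℂ)) * (starRingEnd ℂ) (ℓ n (n-1)) + (d + (n:ℂ)) * ℓ n (n-1)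
        + 2 * (n:ℂ) * ((β:ℂ) - (lam:ℂ)) = 0 := by
  obtain rfl : w = circleJacobiWeight lam β η := funext hw
  have hint := intervalIntegrable_circleJacobiWeight η hlam hβ
  have hintc : IntervalIntegrable (fun θ => (circleJacobiWeight lam β η θ : ℂ)) volume 0
      (2 * Real.pi) := by
    simpa using IntervalIntegrable.mul_circleJacobiWeight η hlam hβ (continuous_const (y := (1 : ℂ)))
  have ho : ∀ n, IsCircleOrthogonal (circleJacobiWeight lam β η) n (Φ n) := by
    intro n k hk
    rw [← circlePairing_conj, ← map_zero (starRingEnd ℂ), ← horth n k hk, circlePairing]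
    congr 2
    funext θ
    rw [eval_pow, eval_X, ← Complex.exp_nat_mul, ← Complex.exp_conj]
    simp [mul_assoc]
  have hh : ∀ n, circlePairing (circleJacobiWeight lam β η) (Φ n) (Φ n) ≠ 0 := fun n =>
    circlePairing_self_ne_zero hint
      (fun θ => by unfold circleJacobiWeight; positivity)
      (fun θ hθ => by
        have hs := sin_half_pos (x := θ) ⟨hθ.1, by linarith [hθ.1, hθ.2]⟩
        have hc := cos_half_pos hθ
        unfold circleJacobiWeight
        positivity) (hmonic n).ne_zero
  have hrec : ∀ n : ℕ, (d + n) * (X * Φ n).coeff n - (d + (n + 1)) * (Φ (n + 1)).coeff n +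
      (starRingEnd ℂ) ((d + n) * (X * Φ n).coeff n - (d + (n + 1)) * (Φ (n + 1)).coeff n) +
      2 * ((lam : ℂ) - β) = 0 := by
    intro n
    have h := circlePairing_pearson η hlam hβ hd (Φ n)
    have hr := circlePairing_conj (w := circleJacobiWeight lam β η) (Φ n) (Φ n)
    simp only [circlePairing_add hintc, circlePairing_C_mul,
      circlePairing_X_sq_mul_derivative hintc hmonic hdeg ho,
      circlePairing_X_mul_self hintc hmonic hdeg ho,
      circlePairing_derivative_self hintc hdeg ho] at h
    simp only [map_add, map_sub, map_mul, hr, map_zero, map_natCast, map_one] at h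
    refine (mul_eq_zero.mp ?_).resolve_left (hh n)
    simp only [map_add, map_sub, map_mul, map_natCast, map_one]
    linear_combination h
  have hmain : ∀ n : ℕ, (starRingEnd ℂ d + (n + 1 : ℕ)) * (starRingEnd ℂ) ((Φ (n + 1)).coeff n) +
      (d + (n + 1 : ℕ)) * (Φ (n + 1)).coeff n + 2 * (n + 1 : ℕ) * ((β : ℂ) - lam) = 0 := by
    intro n
    induction n with
    | zero =>
      have h := hrec 0
      simp only [coeff_X_mul_zero, mul_zero, map_sub, map_mul, map_add, map_natCast, map_one,
        map_zero] at h
      push_cast at h ⊢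
      linear_combination -h
    | succ n ih =>
      have h := hrec (n + 1)
      simp only [coeff_X_mul, map_sub, map_mul, map_add, map_natCast, map_one] at h
      push_cast at h ih ⊢
      linear_combination ih - h
  intro n hn
  obtain ⟨m, rfl⟩ : ∃ m, n = m + 1 := ⟨n - 1, by omega⟩
  simpa only [hℓ, Nat.add_sub_cancel] using hmain m
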